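/- Let A be a unital Banach algebra. If the set of left-invertible (n+1) × 1 matrices over A is dense in A^{n+1}, then for every k ≥ 1 the set of left-invertible (n+k) × k matrices over A is dense in M_{(n+k)×k}(A). -/

import Mathlib

open scoped BigOperators

section Helpers

variable {A : Type*} [NormedRing A]

theorem aux_step {M K : Type*} [Fintype M] [Fintype K] [DecidableEq M] [DecidableEq K]
    (hC : Dense {T : Matrix M Unit A | ∃ Z : Matrix Unit M A, Z * T = 1})
    (hD : Dense {T : Matrix M K A | ∃ Z : Matrix K M A, Z * T = 1}) :
    Dense {T : Matrix (Unit ⊕ M) (Unit ⊕ K) A |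
      ∃ Z : Matrix (Unit ⊕ K) (Unit ⊕ M) A, Z * T = 1} := by
  set P := {T : Matrix (Unit ⊕ M) (Unit ⊕ K) A |
      ∃ Z : Matrix (Unit ⊕ K) (Unit ⊕ M) A, Z * T = 1} with hP
  have key : ∀ (a : Matrix Unit Unit A) (b : Matrix Unit K A) (c : Matrix M Unit A)
      (d : Matrix M K A), (∃ Z : Matrix Unit M A, Z * c = 1) →
      Matrix.fromBlocks a b c d ∈ closure P := by
    rintro a b c d ⟨z, hz⟩
    set w : Matrix Unit M A := (1 - a) * z with hw
    have hwc : w * c = 1 - a := by rw [hw, Matrix.mul_assoc, hz, Matrix.mul_one]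
    set r : Matrix Unit K A := b + w * d with hr
    let f : Matrix M K A → Matrix (Unit ⊕ M) (Unit ⊕ K) A := fun X =>
      (Matrix.fromBlocks 1 (-w) 0 1 : Matrix (Unit ⊕ M) (Unit ⊕ M) A) *
        ((Matrix.fromBlocks 1 0 c 1 : Matrix (Unit ⊕ M) (Unit ⊕ M) A) *
          (Matrix.fromBlocks 1 r 0 X : Matrix (Unit ⊕ M) (Unit ⊕ K) A))
    have hf : Continuous f := by
      refine continuous_const.matrix_mul (continuous_const.matrix_mul ?_)
      exact continuous_const.matrix_fromBlocks continuous_const continuous_const continuous_id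
    have hfT : f (d - c * r) = Matrix.fromBlocks a b c d := by
      simp only [f, Matrix.fromBlocks_multiply]
      simp [Matrix.neg_mul, hwc, hr]
    rw [← hfT]
    refine map_mem_closure hf (hD _) ?_
    rintro X ⟨Z, hZ⟩
    refine ⟨(Matrix.fromBlocks 1 (-(r * Z)) 0 Z : Matrix (Unit ⊕ K) (Unit ⊕ M) A) *
      ((Matrix.fromBlocks 1 0 (-c) 1 : Matrix (Unit ⊕ M) (Unit ⊕ M) A) *
        (Matrix.fromBlocks 1 w 0 1 : Matrix (Unit ⊕ M) (Unit ⊕ M) A)), ?_⟩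
    have h1 : (Matrix.fromBlocks 1 w 0 1 : Matrix (Unit ⊕ M) (Unit ⊕ M) A) *
        Matrix.fromBlocks 1 (-w) 0 1 = 1 := by
      simp [Matrix.fromBlocks_multiply]
    have h2 : (Matrix.fromBlocks 1 0 (-c) 1 : Matrix (Unit ⊕ M) (Unit ⊕ M) A) *
        Matrix.fromBlocks 1 0 c 1 = 1 := by
      simp [Matrix.fromBlocks_multiply]
    have h3 : (Matrix.fromBlocks 1 (-(r * Z)) 0 Z : Matrix (Unit ⊕ K) (Unit ⊕ M) A) *
        (Matrix.fromBlocks 1 r 0 X : Matrix (Unit ⊕ M) (Unit ⊕ K) A) = 1 := by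
      simp [Matrix.fromBlocks_multiply, Matrix.neg_mul, Matrix.mul_assoc, hZ]
    simp only [f]
    rw [Matrix.mul_assoc, Matrix.mul_assoc (Matrix.fromBlocks 1 0 (-c) 1),
      ← Matrix.mul_assoc (Matrix.fromBlocks 1 w 0 1), h1, Matrix.one_mul,
      ← Matrix.mul_assoc (Matrix.fromBlocks 1 0 (-c) 1), h2, Matrix.one_mul, h3]
  intro T
  rw [← closure_closure, ← Matrix.fromBlocks_toBlocks T]
  have hg : Continuous fun c : Matrix M Unit A =>
      Matrix.fromBlocks T.toBlocks₁₁ T.toBlocks₁₂ c T.toBlocks₂₂ :=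
    continuous_const.matrix_fromBlocks continuous_const continuous_id continuous_const
  exact map_mem_closure (f := fun c : Matrix M Unit A =>
      Matrix.fromBlocks T.toBlocks₁₁ T.toBlocks₁₂ c T.toBlocks₂₂) hg (hC T.toBlocks₂₁) fun c hc => key _ _ c _ hc

theorem aux_col {M : Type*} [Fintype M]
    (hC : Dense {T : Matrix M Unit A | ∃ Z : Matrix Unit M A, Z * T = 1}) :
    Dense {T : Matrix (Unit ⊕ M) Unit A | ∃ Z : Matrix Unit (Unit ⊕ M) A, Z * T = 1} := by
  intro T
  rw [← Matrix.fromRows_toRows T]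
  have hg : Continuous fun c : Matrix M Unit A => Matrix.fromRows T.toRows₁ c := by
    refine continuous_matrix fun i j => ?_
    rcases i with i | i
    · exact continuous_const
    · exact continuous_id.matrix_elem i j
  refine map_mem_closure hg (hC T.toRows₂) ?_
  rintro c ⟨Z, hZ⟩
  refine ⟨Matrix.fromCols 0 Z, ?_⟩
  simp [Matrix.fromCols_mul_fromRows, hZ]

theorem aux_reindex {M K M' K' : Type*} [Fintype M] [Fintype M']
    [DecidableEq K] [DecidableEq K'] (e : M ≃ M') (g : K ≃ K')
    (hD : Dense {T : Matrix M K A | ∃ Z : Matrix K M A, Z * T = 1}) :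
    Dense {T : Matrix M' K' A | ∃ Z : Matrix K' M' A, Z * T = 1} := by
  intro T
  have hT : T = (T.submatrix e g).submatrix e.symm g.symm := by simp
  rw [hT]
  have hg : Continuous fun X : Matrix M K A => X.submatrix e.symm g.symm :=
    continuous_id.matrix_submatrix _ _
  refine map_mem_closure (f := fun X : Matrix M K A => X.submatrix e.symm g.symm) hg (hD _) ?_
  rintro X ⟨Z, hZ⟩
  refine ⟨Z.submatrix g.symm e.symm, ?_⟩
  rw [Matrix.submatrix_mul_equiv, hZ, Matrix.submatrix_one_equiv]

end Helpers

/-- If the left-invertible `(n+1) × 1` matrices over a unital Banach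
algebra `A` are dense, then for every `k ≥ 1` the left-invertible `(n+k) × k` matrices
are dense in `M_{(n+k)×k}(A)`  (condition `L_n(1)` implies `L_n(k)`). -/
theorem stmt2 {A : Type*} [NormedRing A] [CompleteSpace A] (n : ℕ)
    (h1 : Dense {T : Matrix (Fin (n + 1)) (Fin 1) A |
      ∃ Z : Matrix (Fin 1) (Fin (n + 1)) A, Z * T = 1})
    (k : ℕ) (hk : 1 ≤ k) :
    Dense {T : Matrix (Fin (n + k)) (Fin k) A |
      ∃ Z : Matrix (Fin k) (Fin (n + k)) A, Z * T = 1} := by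
  have e : ∀ m : ℕ, Nonempty (Unit ⊕ Fin m ≃ Fin (m + 1)) := fun m =>
    ⟨Fintype.equivOfCardEq (by simp [add_comm])⟩
  have hcol : ∀ k : ℕ, 1 ≤ k → Dense {T : Matrix (Fin (n + k)) Unit A |
      ∃ Z : Matrix Unit (Fin (n + k)) A, Z * T = 1} := by
    intro k hk
    induction k, hk using Nat.le_induction with
    | base => exact aux_reindex (Equiv.refl _) (Fintype.equivOfCardEq (by simp)) h1
    | succ k hk ih =>
      exact aux_reindex (e (n + k)).some (Equiv.refl _) (aux_col ih)
  induction k, hk using Nat.le_induction with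
  | base => exact h1
  | succ k hk ih =>
    exact aux_reindex (e (n + k)).some (e k).some (aux_step (hcol k hk) ih)
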